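/- For every integer n ≥ 1, define U_n = ∑_{r=0}^{n} (-1)^r q^{r(r-1)/2} (-q;q)_{n-r} [2n-r+1 choose r]_q. Then the following identity holds in ℚ(q): ∑_{r=0}^{n} (-1)^r q^{(r-1)(r-2)/2} (-q;q)_{n-r} [2n-r+1 choose r]_q · (1-q^{2n+1})/(1-q^{2n-r+1}) = -U_{n-1} + q·U_n. (Here the exponent (r-1)(r-2)/2 is the polynomial value of the binomial coefficient C(r-1,2); in particular it equals 1 when r = 0.) -/

import Mathlib

open Finset

/-- The indeterminate `q`, as an element of the field `ℚ(q)` of rational functions. -/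
noncomputable def q : RatFunc ℚ := RatFunc.X

/-- The q-Pochhammer symbol `(a; q)_n` for a nonnegative integer `n`. -/
noncomputable def qPoch (a : RatFunc ℚ) (n : ℕ) : RatFunc ℚ :=
  ∏ k ∈ Finset.range n, (1 - a * q ^ k)

/-- The q-Pochhammer symbol `(a; q)_n` for an arbitrary integer `n`, where for `n > 0`
`(a; q)_{-n} = 1 / (a q^{-n}; q)_n`. -/
noncomputable def qPochZ (a : RatFunc ℚ) (n : ℤ) : RatFunc ℚ :=
  if 0 ≤ n then qPoch a n.toNat else 1 / qPoch (a * q ^ n) (-n).toNat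

/-- The Gaussian (q-)binomial coefficient `[n choose m]_q`, equal to
`(q;q)_n / ((q;q)_m (q;q)_{n-m})` for `0 ≤ m ≤ n` and `0` otherwise. -/
noncomputable def qbinom (n m : ℤ) : RatFunc ℚ :=
  if 0 ≤ m ∧ m ≤ n then
    qPoch q n.toNat / (qPoch q m.toNat * qPoch q (n - m).toNat)
  else 0

/-- `U_n = ∑_{r=0}^n (-1)^r q^(C(r,2)) (-q;q)_(n-r) [2n-r+1, r]_q`. -/
noncomputable def Un (n : ℕ) : RatFunc ℚ :=
  ∑ r ∈ Finset.range (n + 1),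
    (-1 : RatFunc ℚ) ^ r * q ^ (r * (r - 1) / 2) * qPoch (-q) (n - r) *
      qbinom (2 * (n : ℤ) - r + 1) r

theorem q_ne_zero : q ≠ 0 := RatFunc.X_ne_zero

theorem one_sub_q_pow_ne_zero (k : ℕ) : 1 - q ^ (k + 1) ≠ 0 := by
  have h : (1 - Polynomial.X ^ (k + 1) : Polynomial ℚ) ≠ 0 := by
    intro h
    simpa using congrArg (Polynomial.eval 0) h
  intro h'
  apply h
  apply RatFunc.algebraMap_injective ℚ
  simpa [q] using h'

theorem qPoch_q_succ (k : ℕ) : qPoch q (k + 1) = qPoch q k * (1 - q ^ (k + 1)) := by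
  rw [qPoch, prod_range_succ, ← qPoch, pow_succ']

theorem qPoch_q_ne_zero (k : ℕ) : qPoch q k ≠ 0 := by
  refine prod_ne_zero_iff.mpr fun i _ => ?_
  rw [← pow_succ']
  exact one_sub_q_pow_ne_zero i

theorem qbinom_natCast {m s : ℕ} (h : s ≤ m) :
    qbinom m s = qPoch q m / (qPoch q s * qPoch q (m - s)) := by
  rw [qbinom, if_pos (by omega), ← Nat.cast_sub h]
  simp only [Int.toNat_natCast]

theorem qbinom_succ_mul {m s : ℕ} (h : s ≤ m) :
    qbinom (m + 1 : ℕ) (s + 1 : ℕ) * (1 - q ^ (s + 1)) = qbinom m s * (1 - q ^ (m + 1)) := by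
  rw [qbinom_natCast h, qbinom_natCast (Nat.add_le_add_right h 1), Nat.add_sub_add_right,
    qPoch_q_succ, qPoch_q_succ]
  have h₁ := qPoch_q_ne_zero s
  have h₂ := qPoch_q_ne_zero (m - s)
  have h₃ := one_sub_q_pow_ne_zero s
  field_simp

theorem shifted_exponent (r : ℕ) :
    ((r : ℤ) - 1) * ((r : ℤ) - 2) / 2 + r = (r * (r - 1) / 2 : ℕ) + 1 := by
  cases r with
  | zero => norm_num
  | succ s =>
    have h : ((s + 1 : ℕ) - 1 : ℤ) * ((s + 1 : ℕ) - 2) = (s + 1) * s + (-s) * 2 := by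
      push_cast; ring
    rw [h, Int.add_mul_ediv_right _ _ two_ne_zero]
    push_cast [Nat.add_sub_cancel]
    ring

theorem shifted_exponent_succ (s : ℕ) :
    (((s + 1 : ℕ) : ℤ) - 1) * (((s + 1 : ℕ) : ℤ) - 2) / 2 = (s * (s - 1) / 2 : ℕ) := by
  have h := shifted_exponent (s + 1)
  have h' : (s + 1) * (s + 1 - 1) / 2 = s * (s - 1) / 2 + s := by
    rw [← Nat.choose_two_right, ← Nat.choose_two_right, Nat.choose_succ_succ' s 1,
      Nat.choose_one_right, add_comm]
  rw [h'] at h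
  push_cast at h ⊢
  linarith

/-- The identity from the proof of Theorem 2.3. -/
theorem U_shifted_identity (n : ℕ) (hn : 1 ≤ n) :
    ∑ r ∈ Finset.range (n + 1),
        (-1 : RatFunc ℚ) ^ r * q ^ (((r : ℤ) - 1) * ((r : ℤ) - 2) / 2) * qPoch (-q) (n - r) *
          qbinom (2 * (n : ℤ) - r + 1) r *
          ((1 - q ^ (2 * n + 1)) / (1 - q ^ (2 * (n : ℤ) - r + 1))) =
      -Un (n - 1) + q * Un n := by
  obtain ⟨n, rfl⟩ := Nat.exists_eq_add_of_le' hn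
  have split : ∀ r ∈ range (n + 1 + 1),
      (-1 : RatFunc ℚ) ^ r * q ^ (((r : ℤ) - 1) * ((r : ℤ) - 2) / 2) * qPoch (-q) (n + 1 - r) *
          qbinom (2 * ((n + 1 : ℕ) : ℤ) - r + 1) r *
          ((1 - q ^ (2 * (n + 1) + 1)) / (1 - q ^ (2 * ((n + 1 : ℕ) : ℤ) - r + 1))) =
      (-1 : RatFunc ℚ) ^ r * q ^ (((r : ℤ) - 1) * ((r : ℤ) - 2) / 2) * qPoch (-q) (n + 1 - r) *
          (qbinom (2 * ((n + 1 : ℕ) : ℤ) - r + 1) r * (1 - q ^ r) /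
            (1 - q ^ (2 * ((n + 1 : ℕ) : ℤ) - r + 1))) +
      q * ((-1 : RatFunc ℚ) ^ r * q ^ (r * (r - 1) / 2) * qPoch (-q) (n + 1 - r) *
          qbinom (2 * ((n + 1 : ℕ) : ℤ) - r + 1) r) := by
    intro r hr
    rw [mem_range] at hr
    obtain ⟨m, hm⟩ : ∃ m : ℕ, m + 1 + r = 2 * (n + 1) + 1 := ⟨2 * (n + 1) - r, by omega⟩
    have hm' : 2 * ((n + 1 : ℕ) : ℤ) - r + 1 = (m + 1 : ℕ) := by omega
    have hq : q ^ (((r : ℤ) - 1) * ((r : ℤ) - 2) / 2) * q ^ r = q * q ^ (r * (r - 1) / 2) := by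
      rw [← zpow_natCast q r, ← zpow_add₀ q_ne_zero, shifted_exponent, zpow_add_one₀ q_ne_zero,
        zpow_natCast, mul_comm]
    have h := one_sub_q_pow_ne_zero m
    rw [hm', zpow_natCast, ← hm, pow_add q (m + 1) r]
    field_simp
    linear_combination (1 - q ^ (m + 1)) * qPoch (-q) (n + 1 - r) * qbinom (m + 1 : ℕ) r * hq
  rw [sum_congr rfl split, sum_add_distrib, ← mul_sum, ← Un, sum_range_succ', Nat.add_sub_cancel]
  congr 1
  rw [pow_zero q, sub_self, mul_zero, zero_div, mul_zero, add_zero, Un, ← sum_neg_distrib]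
  refine sum_congr rfl fun s hs => ?_
  rw [mem_range] at hs
  obtain ⟨m, hm⟩ : ∃ m : ℕ, m + s = 2 * n + 1 := ⟨2 * n + 1 - s, by omega⟩
  have hm₁ : 2 * ((n + 1 : ℕ) : ℤ) - (s + 1 : ℕ) + 1 = (m + 1 : ℕ) := by omega
  have hm₂ : 2 * (n : ℤ) - s + 1 = m := by omega
  rw [hm₁, hm₂, zpow_natCast, qbinom_succ_mul (by omega),
    mul_div_cancel_right₀ _ (one_sub_q_pow_ne_zero m), shifted_exponent_succ, zpow_natCast,
    Nat.add_sub_add_right]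
  ring
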